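/- For every point-shift F and every n ∈ ℕ, the Palm expectation of the number of n-th order descendants of the origin equals one: E_{μ_0}[d_n(0)] = 1, where d_n(0) := #{y ∈ ω : F_ω^n(y) = 0}. In particular, d_n(0) is finite for μ_0-almost every ω. -/

import Mathlib

open Function Set MeasureTheory ProbabilityTheory
open scoped ENNReal NNReal

namespace PointShift

/-- Points of the grid `ℤ^d`. -/
abbrev Pt (d : ℕ) := Fin d → ℤ

/-- Configurations: subsets of the grid `ℤ^d`, identified with `{0,1}`-valued
functions, equipped with the product σ-algebra. -/
abbrev Conf (d : ℕ) := Pt d → Bool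

/-- The shift `θ_t ω = ω - t`. -/
def shift {d : ℕ} (t : Pt d) (ω : Conf d) : Conf d := fun x => ω (x + t)

/-- The support of a configuration, as a subset of `ℤ^d`. -/
def pts {d : ℕ} (ω : Conf d) : Set (Pt d) := {x | ω x = true}

/-- `g` is a point-map: it is measurable and selects a point of every
configuration having a point at the origin. -/
def IsPointMap {d : ℕ} (g : Conf d → Pt d) : Prop :=
  Measurable g ∧ ∀ ω : Conf d, ω 0 = true → ω (g ω) = true

/-- The point-shift associated with a point-map `g`: `F_ω x = x + g (θ_x ω)`. -/
def Fps {d : ℕ} (g : Conf d → Pt d) (ω : Conf d) (x : Pt d) : Pt d :=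
  x + g (shift x ω)

/-- `μ` is a stationary point process on the grid: a shift-invariant probability
measure with a point at the origin with positive probability. -/
def IsStationaryPP {d : ℕ} (μ : Measure (Conf d)) : Prop :=
  IsProbabilityMeasure μ ∧ (∀ t : Pt d, μ.map (shift t) = μ) ∧
    0 < μ {ω : Conf d | ω 0 = true}

/-- The Palm probability of `μ`: `μ` conditioned on having a point at the origin. -/
noncomputable def Palm {d : ℕ} (μ : Measure (Conf d)) : Measure (Conf d) :=
  μ[|{ω : Conf d | ω 0 = true}]

/-- The foil of the point `x` in the configuration `ω`, for the point-shift of `g`. -/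
def foilOn {d : ℕ} (g : Conf d → Pt d) (ω : Conf d) (x : Pt d) : Set (Pt d) :=
  {y | ω y = true ∧ ∃ n : ℕ, (Fps g ω)^[n] y = (Fps g ω)^[n] x}

/-- The connected component of the point `x` in the functional graph `G^F(ω)`. -/
def compOn {d : ℕ} (g : Conf d → Pt d) (ω : Conf d) (x : Pt d) : Set (Pt d) :=
  {y | ω y = true ∧ ∃ m n : ℕ, (Fps g ω)^[m] x = (Fps g ω)^[n] y}

/-- `K` is a directed cycle of the functional graph of `f`: a finite set of
distinct points `c 0, …, c (k-1)` (with `k ≥ 1`) such that `f (c i) = c ((i+1) % k)`. -/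
def IsCycle {X : Type*} (f : X → X) (K : Set X) : Prop :=
  ∃ (k : ℕ) (c : ℕ → X), 0 < k ∧
    (∀ i < k, ∀ j < k, c i = c j → i = j) ∧
    (∀ i < k, f (c i) = c ((i + 1) % k)) ∧
    K = c '' {i | i < k}

end PointShift

namespace PointShift

variable {d : ℕ}

lemma shift_shift (s t : Pt d) (ω : Conf d) : shift s (shift t ω) = shift (s + t) ω := by
  funext x
  simp only [shift, add_assoc]

@[fun_prop]
lemma measurable_shift (t : Pt d) : Measurable (shift t : Conf d → Conf d) :=
  measurable_pi_lambda _ fun x => measurable_pi_apply (x + t)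

/-- Equivariance of the iterates of a point-shift. -/
lemma iterate_Fps_shift (g : Conf d → Pt d) (ω : Conf d) (t : Pt d) (n : ℕ) (x : Pt d) :
    (Fps g (shift t ω))^[n] x = (Fps g ω)^[n] (x + t) - t := by
  induction n generalizing x with
  | zero => simp
  | succ n ih =>
    simp only [iterate_succ_apply, ih]
    congr 2
    simp only [Fps, shift_shift]
    abel

/-- Iterates of a point-shift map points of the configuration to points of the configuration. -/
lemma IsPointMap.iterate_Fps_mem {g : Conf d → Pt d} (hg : IsPointMap g) (ω : Conf d) (n : ℕ)
    {x : Pt d} (hx : ω x = true) : ω ((Fps g ω)^[n] x) = true := by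
  induction n generalizing x with
  | zero => exact hx
  | succ n ih =>
    rw [iterate_succ_apply]
    refine ih ?_
    have h := hg.2 (shift x ω) (by simpa [shift] using hx)
    rwa [shift, add_comm] at h

lemma measurable_iterate_Fps {g : Conf d → Pt d} (hg : Measurable g) (n : ℕ) (x : Pt d) :
    Measurable fun ω => (Fps g ω)^[n] x := by
  induction n with
  | zero => exact measurable_const
  | succ n ih =>
    simp only [iterate_succ_apply']
    have h : Measurable (uncurry fun (y : Pt d) (ω : Conf d) => Fps g ω y) :=
      measurable_from_prod_countable_right fun y =>
        (hg.comp (measurable_shift y)).const_add y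
    exact h.comp (ih.prodMk measurable_id)

lemma measurableSet_apply_eq_true (x : Pt d) : MeasurableSet {ω : Conf d | ω x = true} :=
  (measurable_pi_apply (X := fun _ : Pt d => Bool) x) (measurableSet_singleton true)

/-- The `n`-th order descendants of the origin. -/
def descendants (g : Conf d → Pt d) (n : ℕ) (ω : Conf d) : Set (Pt d) :=
  {y | ω y = true ∧ (Fps g ω)^[n] y = 0}

lemma measurableSet_mem_descendants {g : Conf d → Pt d} (hg : Measurable g) (n : ℕ) (y : Pt d) :
    MeasurableSet {ω | y ∈ descendants g n ω} :=
  (measurableSet_apply_eq_true y).inter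
    (measurable_iterate_Fps hg n y (measurableSet_singleton 0))

lemma encard_descendants (g : Conf d → Pt d) (n : ℕ) (ω : Conf d) :
    ((descendants g n ω).encard : ℝ≥0∞) =
      ∑' y, {ω | y ∈ descendants g n ω}.indicator 1 ω := by
  rw [← ENNReal.tsum_set_one, tsum_subtype (descendants g n ω) fun _ => (1 : ℝ≥0∞)]
  rfl

lemma measurable_encard_descendants {g : Conf d → Pt d} (hg : Measurable g) (n : ℕ) :
    Measurable fun ω => ((descendants g n ω).encard : ℝ≥0∞) := by
  simp only [encard_descendants]
  exact Measurable.tsum fun y =>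
    measurable_one.indicator (measurableSet_mem_descendants hg n y)

/-- Mass transport: the points `y` send mass to the origin as the origin sends mass to `-y`. -/
lemma measure_mem_descendants_inter {μ : Measure (Conf d)}
    (hinv : ∀ t : Pt d, μ.map (shift t) = μ) {g : Conf d → Pt d} (hg : Measurable g)
    (n : ℕ) (y : Pt d) :
    μ ({ω | y ∈ descendants g n ω} ∩ {ω | ω 0 = true}) =
      μ ({ω | ω 0 = true ∧ ω (-y) = true} ∩ {ω | (Fps g ω)^[n] 0 = -y}) := by
  have hm : MeasurableSet
      ({ω : Conf d | ω 0 = true ∧ ω (-y) = true} ∩ {ω | (Fps g ω)^[n] 0 = -y}) :=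
    ((measurableSet_apply_eq_true 0).inter (measurableSet_apply_eq_true (-y))).inter
      (measurable_iterate_Fps hg n 0 (measurableSet_singleton (-y)))
  conv_rhs => rw [← hinv y, Measure.map_apply (measurable_shift y) hm]
  congr 1
  ext ω
  simp only [descendants, mem_inter_iff, mem_ofPred_eq, mem_preimage, iterate_Fps_shift,
    zero_add, shift, neg_add_cancel, sub_eq_neg_self]
  tauto

lemma tsum_measure_iterate_Fps_zero (μ : Measure (Conf d)) {g : Conf d → Pt d}
    (hg : IsPointMap g) (n : ℕ) :
    ∑' y : Pt d, μ ({ω | ω 0 = true ∧ ω (-y) = true} ∩ {ω | (Fps g ω)^[n] 0 = -y}) =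
      μ {ω | ω 0 = true} := by
  rw [← measure_iUnion]
  · congr 1
    ext ω
    simp only [mem_iUnion, mem_inter_iff, mem_ofPred_eq]
    refine ⟨fun ⟨_, h, _⟩ => h.1, fun h => ⟨-(Fps g ω)^[n] 0, ?_⟩⟩
    simp [h, hg.iterate_Fps_mem ω n h]
  · intro y z hyz
    refine Set.disjoint_left.2 fun ω hy hz => hyz ?_
    exact neg_injective (hy.2.symm.trans hz.2)
  · intro y
    exact ((measurableSet_apply_eq_true 0).inter (measurableSet_apply_eq_true (-y))).inter
      (measurable_iterate_Fps hg.1 n 0 (measurableSet_singleton (-y)))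

/-- The expected number of `n`-th order descendants of the origin is one. -/
lemma lintegral_encard_descendants {μ : Measure (Conf d)} [IsFiniteMeasure μ]
    (hinv : ∀ t : Pt d, μ.map (shift t) = μ) (hpos : 0 < μ {ω : Conf d | ω 0 = true})
    {g : Conf d → Pt d} (hg : IsPointMap g) (n : ℕ) :
    ∫⁻ ω, ((descendants g n ω).encard : ℝ≥0∞) ∂(Palm μ) = 1 := by
  have hD := measurableSet_mem_descendants hg.1 n
  simp only [encard_descendants, Palm, ProbabilityTheory.cond, lintegral_smul_measure, smul_eq_mul]
  rw [lintegral_tsum fun y => (measurable_one.indicator (hD y)).aemeasurable]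
  simp only [lintegral_indicator_one (hD _), Measure.restrict_apply (hD _),
    measure_mem_descendants_inter hinv hg.1, tsum_measure_iterate_Fps_zero μ hg]
  exact ENNReal.inv_mul_cancel hpos.ne' (measure_ne_top _ _)

end PointShift

/-- For every point-shift `F` and every `n`, the Palm expectation of the
number `d_n(0)` of `n`-th order descendants of the origin equals `1`; in particular
`d_n(0)` is finite for `μ₀`-almost every configuration. -/
theorem stmt_7 {d : ℕ} (hd : 0 < d)
    (μ : Measure (PointShift.Conf d)) [IsProbabilityMeasure μ]
    (hinv : ∀ t : PointShift.Pt d, μ.map (PointShift.shift t) = μ)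
    (hpos : 0 < μ {ω : PointShift.Conf d | ω 0 = true})
    (g : PointShift.Conf d → PointShift.Pt d) (hg : PointShift.IsPointMap g)
    (n : ℕ) :
    ∫⁻ ω, ({y : PointShift.Pt d | ω y = true ∧ (PointShift.Fps g ω)^[n] y = 0}.encard
        : ℝ≥0∞) ∂(PointShift.Palm μ) = 1 ∧
    ∀ᵐ ω ∂(PointShift.Palm μ),
      {y : PointShift.Pt d | ω y = true ∧ (PointShift.Fps g ω)^[n] y = 0}.Finite := by
  have h := PointShift.lintegral_encard_descendants hinv hpos hg n
  refine ⟨h, ?_⟩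
  filter_upwards [ae_lt_top (PointShift.measurable_encard_descendants hg.1 n)
    (h ▸ ENNReal.one_ne_top)] with ω hω
  exact encard_lt_top_iff.1 (ENat.toENNReal_lt_top.1 hω)
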